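/- Suppose 2 ≤ s ≤ r. (a) If 2 ≤ s ≤ r − ⌊r/m⌋ − 1, then the set of all arithmetic pure gaps at the indices (1, 2, …, s) equals the union over k = 0, 1, …, r − ⌊r/m⌋ − 1 − s of the sets { (m·k_1 + j_1, …, m·k_s + j_s) : k_1, …, k_s are nonnegative integers with ∑_{i=1}^{s} k_i = k, and there exists a permutation σ of {1, …, s} such that 1 ≤ j_{σ(i)} ≤ m − ⌈m·(k+i)/r⌉ for all 1 ≤ i ≤ s }. (b) If r − ⌊r/m⌋ ≤ s ≤ r, then there are no arithmetic pure gaps at (1, 2, …, s). -/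

import Mathlib

open Finset

/-- Floor of the rational number `x / m`. -/
noncomputable def fdivq (m : ℕ) (x : ℤ) : ℤ := ⌊(x : ℚ) / (m : ℚ)⌋

/-- The quantity `∑_{i=0}^{n-1} ⌊(a_i + t·λ_{c i})/m⌋ + ∑_{w ∉ range c} ⌊t·λ_w/m⌋`. -/
noncomputable def gapSum (m r n : ℕ) (lam : Fin (r + 1) → ℤ)
    (c : Fin n → Fin (r + 1)) (a : Fin n → ℤ) (t : ℤ) : ℤ :=
  (∑ i : Fin n, fdivq m (a i + t * lam (c i))) +
    ∑ w ∈ Finset.univ \ Finset.image c Finset.univ, fdivq m (t * lam w)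

/-- `(a 0, …, a (n-1))` is an *arithmetic pure gap* at the (pairwise distinct) indices
`c 0, …, c (n-1)` of `{0,…,r}`: the entries are nonnegative and for every
`t ∈ {0,…,m-1}` exactly one of the two Bartoli–Quoos–Zini conditions holds. -/
noncomputable def IsArithPureGap (m r n : ℕ) (lam : Fin (r + 1) → ℤ)
    (c : Fin n → Fin (r + 1)) (a : Fin n → ℤ) : Prop :=
  (∀ i, 0 ≤ a i) ∧
    ∀ t : ℤ, 0 ≤ t → t ≤ (m : ℤ) - 1 →
      Xor' (gapSum m r n lam c a t < 0)
        (0 ≤ gapSum m r n lam c a t ∧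
          ∀ i : Fin n, fdivq m (a i + t * lam (c i)) = fdivq m (a i + t * lam (c i) - 1))

theorem fdivq_eq_ediv (m : ℕ) (x : ℤ) : fdivq m x = x / m :=
  Rat.floor_intCast_div_natCast x m

theorem ediv_eq_ediv_sub_one_iff {m : ℤ} (hm : 0 < m) (x : ℤ) :
    x / m = (x - 1) / m ↔ ¬ m ∣ x := by
  have h1 := Int.emod_add_mul_ediv x m
  have h2 := Int.emod_nonneg x hm.ne'
  have h3 := Int.emod_lt_of_pos x hm
  rw [Int.dvd_iff_emod_eq_zero, eq_comm, Int.ediv_eq_iff_of_pos hm]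
  constructor
  · rintro ⟨h4, -⟩ h5
    nlinarith
  · intro h5
    have h6 : 1 ≤ x % m := by omega
    constructor <;> nlinarith

theorem gapSum_eq_of_equal_multiplicities {m r s : ℕ} (hm : 0 < m) (l : ℤ)
    (lam : Fin (r + 1) → ℤ)
    (hlam : ∀ i : Fin (r + 1), lam i = if i = 0 then -(r : ℤ) * l else l)
    (c : Fin s → Fin (r + 1)) (hc : Function.Injective c) (hc0 : ∀ i, c i ≠ 0)
    (a : Fin s → ℤ) (t : ℤ) :
    gapSum m r s lam c a t =
      ∑ i, (a i + (t * l) % m) / m + (-(r * ((t * l) % m))) / m := by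
  have hm0 : (m : ℤ) ≠ 0 := by positivity
  have hcl : ∀ i, lam (c i) = l := fun i => by rw [hlam, if_neg (hc0 i)]
  set u := (t * l) % m with hu
  set q := (t * l) / m with hq
  have hdiv : t * l = u + m * q := (Int.emod_add_mul_ediv _ _).symm
  have hcompl := Finset.sum_sdiff (f := fun w => fdivq m (t * lam w))
    (Finset.subset_univ (Finset.image c Finset.univ))
  rw [Finset.sum_image (fun _ _ _ _ h => hc h), Fin.sum_univ_succ] at hcompl
  simp only [hcl] at hcompl
  have hzero : t * lam 0 = -(r * u) + m * (-(r * q)) := by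
    rw [hlam, if_pos rfl]
    linear_combination (-(r : ℤ)) * hdiv
  have hsucc : ∀ i : Fin r, lam i.succ = l := fun i => by
    rw [hlam, if_neg (Fin.succ_ne_zero i)]
  simp only [hsucc, hzero, fdivq_eq_ediv, Int.add_mul_ediv_left _ _ hm0, Finset.sum_const,
    Finset.card_univ, Fintype.card_fin, nsmul_eq_mul, ← hq] at hcompl
  have hsum : ∑ i, fdivq m (a i + t * lam (c i)) = ∑ i, (a i + u) / m + s * q := by
    simp only [hcl, fdivq_eq_ediv, hdiv, ← add_assoc, Int.add_mul_ediv_left _ _ hm0,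
      Finset.sum_add_distrib, Finset.sum_const, Finset.card_univ, Fintype.card_fin,
      nsmul_eq_mul]
  rw [gapSum, hsum]
  simp only [fdivq_eq_ediv]
  linarith

/-- The pure gap criterion in terms of the residue `u` of `t * l` modulo `m`. -/
theorem isArithPureGap_iff_forall_residue {m r s : ℕ} (hm : 0 < m) (l : ℤ)
    (hml : IsCoprime (m : ℤ) l) (lam : Fin (r + 1) → ℤ)
    (hlam : ∀ i : Fin (r + 1), lam i = if i = 0 then -(r : ℤ) * l else l)
    (c : Fin s → Fin (r + 1)) (hc : Function.Injective c) (hc0 : ∀ i, c i ≠ 0)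
    (a : Fin s → ℤ) :
    IsArithPureGap m r s lam c a ↔ (∀ i, 0 ≤ a i) ∧ ∀ u : ℤ, 0 ≤ u → u < m →
      (∑ i, (a i + u) / m + (-(r * u)) / m < 0 ∨ ∀ i, ¬ (m : ℤ) ∣ a i + u) := by
  have hm' : (0 : ℤ) < m := by exact_mod_cast hm
  have hcl : ∀ i, lam (c i) = l := fun i => by rw [hlam, if_neg (hc0 i)]
  have hdvd : ∀ (i : Fin s) (t : ℤ),
      (m : ℤ) ∣ a i + t * l ↔ (m : ℤ) ∣ a i + (t * l) % m := fun i t => by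
    rw [Int.dvd_iff_emod_eq_zero, Int.dvd_iff_emod_eq_zero, Int.add_emod_emod]
  unfold IsArithPureGap
  refine and_congr_right fun _ => ?_
  simp only [gapSum_eq_of_equal_multiplicities hm l lam hlam c hc hc0, hcl, fdivq_eq_ediv,
    ediv_eq_ediv_sub_one_iff hm', hdvd]
  constructor
  · intro h u hu0 hum
    obtain ⟨x, y, hxy⟩ := hml
    have hmod : (u * y) % m * l % m = u := by
      rw [Int.mul_emod, Int.emod_emod_of_dvd _ dvd_rfl, ← Int.mul_emod]
      have : u * y * l = u + m * (-(u * x)) := by linear_combination u * hxy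
      rw [this, Int.add_mul_emod_self_left, Int.emod_eq_of_lt hu0 hum]
    have := h ((u * y) % m) (Int.emod_nonneg _ hm'.ne')
      (by have := Int.emod_lt_of_pos (u * y) hm'; omega)
    rw [hmod] at this
    rcases this with h1 | h1
    · exact Or.inl h1.1
    · exact Or.inr h1.1.2
  · intro h t _ _
    have := h ((t * l) % m) (Int.emod_nonneg _ hm'.ne') (Int.emod_lt_of_pos _ hm')
    rcases lt_or_ge (∑ i, (a i + (t * l) % m) / (m : ℤ) + (-(r * ((t * l) % m))) / (m : ℤ)) 0
      with h1 | h1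
    · exact Or.inl ⟨h1, fun h2 => absurd h1 (not_lt.mpr h2.1)⟩
    · exact Or.inr ⟨⟨h1, this.resolve_left (not_lt.mpr h1)⟩, not_lt.mpr h1⟩

theorem mul_add_add_ediv {m k j u : ℤ} (hj : 0 ≤ j) (hjm : j < m) (hu : 0 ≤ u)
    (hum : u < m) : (m * k + j + u) / m = k + if m ≤ j + u then 1 else 0 := by
  rw [Int.ediv_eq_iff_of_pos (by omega)]
  split_ifs <;> constructor <;> nlinarith

theorem dvd_mul_add_add_iff {m k j u : ℤ} (hj : 1 ≤ j) (hjm : j < m) (hu : 0 ≤ u)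
    (hum : u < m) : m ∣ m * k + j + u ↔ j + u = m := by
  rw [add_assoc, Int.dvd_add_right (dvd_mul_right m k)]
  constructor
  · rintro ⟨d, hd⟩
    have h1 : 0 < d := by
      by_contra! h
      nlinarith
    have h2 : d < 2 := by
      by_contra! h
      nlinarith
    obtain rfl : d = 1 := by omega
    omega
  · intro h
    rw [h]

/-- For nonzero remainders `j i`, the pure gap criterion only has to be tested at the residues
`m - j i`, where it compares the number of remainders `≥ j i` with `r * (m - j i) / m`. -/
theorem forall_residue_iff_card_bound {m r s : ℕ} (hmr : IsCoprime (m : ℤ) r)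
    (k j : Fin s → ℤ) (hj : ∀ i, 1 ≤ j i) (hjm : ∀ i, j i < m) :
    (∀ u : ℤ, 0 ≤ u → u < m →
      (∑ i, (m * k i + j i + u) / m + (-(r * u)) / m < 0 ∨
        ∀ i, ¬ (m : ℤ) ∣ m * k i + j i + u)) ↔
    ∀ i, (m : ℤ) * (∑ x, k x + #{x | j i ≤ j x}) ≤ r * (m - j i) := by
  have hsum : ∀ i, ∑ x, (m * k x + j x + (m - j i)) / (m : ℤ) =
      ∑ x, k x + #{x | j i ≤ j x} := fun i => by
    have h0 : ∀ x, (m * k x + j x + (m - j i)) / (m : ℤ) =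
        k x + if j i ≤ j x then 1 else 0 := fun x => by
      rw [mul_add_add_ediv (by linarith [hj x]) (hjm x) (by linarith [hjm i])
        (by linarith [hj i])]
      congr 1
      exact if_congr (by constructor <;> intro h <;> linarith) rfl rfl
    simp only [h0, Finset.sum_add_distrib, Finset.sum_boole]
  have hneg : ∀ i, (∑ x, (m * k x + j x + (m - j i)) / (m : ℤ) +
      (-(r * (m - j i))) / (m : ℤ) < 0) ↔
      (m : ℤ) * (∑ x, k x + #{x | j i ≤ j x}) ≤ r * (m - j i) := fun i => by
    have hmpos : (0 : ℤ) < m := by linarith [hj i, hjm i]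
    rw [hsum i, ← lt_neg_iff_add_neg', Int.ediv_lt_iff_lt_mul hmpos]
    generalize (∑ x, k x + (#{x | j i ≤ j x} : ℤ)) = N
    constructor
    · intro h
      nlinarith
    · intro h
      rcases h.lt_or_eq with h | h
      · nlinarith
      · exfalso
        have hd : (m : ℤ) ∣ r * j i := ⟨r - N, by linear_combination h⟩
        have := Int.le_of_dvd (by linarith [hj i]) (hmr.dvd_of_dvd_mul_left hd)
        linarith [hjm i]
  constructor
  · intro h i
    refine (hneg i).1 ((h (m - j i) (by linarith [hjm i]) (by linarith [hj i])).resolve_right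
      fun h1 => h1 i ?_)
    rw [dvd_mul_add_add_iff (hj i) (hjm i) (by linarith [hjm i]) (by linarith [hj i])]
    ring
  · intro h u hu0 hum
    by_cases h1 : ∃ i, (m : ℤ) ∣ m * k i + j i + u
    · obtain ⟨i, hi⟩ := h1
      rw [dvd_mul_add_add_iff (hj i) (hjm i) hu0 hum] at hi
      obtain rfl : u = m - j i := by linarith
      exact Or.inl ((hneg i).2 (h i))
    · exact Or.inr (not_exists.mp h1)

/-- A condition on the number of values `≥ j i`, antitone in that number and in `j i`, can be
tested along some enumeration of the values. -/
theorem forall_card_iff_exists_perm {s : ℕ} (j : Fin s → ℤ) (P : ℕ → ℤ → Prop)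
    (hP : ∀ n n' x x', n ≤ n' → x ≤ x' → P n' x' → P n x) :
    (∀ i, P #{x | j i ≤ j x} (j i)) ↔
      ∃ σ : Equiv.Perm (Fin s), ∀ i : Fin s, P (i + 1) (j (σ i)) := by
  constructor
  · intro h
    refine ⟨Tuple.sort (fun i => -j i), fun i => hP _ _ _ _ ?_ le_rfl (h _)⟩
    have hmono := Tuple.monotone_sort (fun i => -j i)
    rw [← Fin.card_Iic i, ← Finset.card_map (Tuple.sort (fun i => -j i)).toEmbedding]
    refine Finset.card_le_card fun x hx => ?_
    obtain ⟨y, hy, rfl⟩ := Finset.mem_map.mp hx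
    have := hmono (Finset.mem_Iic.mp hy)
    simp only [Function.comp_apply, neg_le_neg_iff] at this
    simpa using this
  · rintro ⟨σ, h⟩ i
    have hne : ({y | j i ≤ j (σ y)} : Finset (Fin s)).Nonempty := ⟨σ.symm i, by simp⟩
    set p := Finset.max' _ hne
    have hmem : j i ≤ j (σ p) := by
      simpa using Finset.max'_mem _ hne
    refine hP _ _ _ _ ?_ hmem (h p)
    rw [← Fin.card_Iic p, ← Finset.card_map σ.symm.toEmbedding]
    refine Finset.card_le_card fun x hx => ?_
    obtain ⟨y, hy, rfl⟩ := Finset.mem_map.mp hx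
    refine Finset.mem_Iic.mpr (Finset.le_max' _ _ ?_)
    simpa using hy

theorem le_sub_ceil_div_iff {m r : ℕ} (hr : 0 < r) (n x : ℤ) :
    x ≤ (m : ℤ) - ⌈((m : ℚ) * n) / (r : ℚ)⌉ ↔ (m : ℤ) * n ≤ r * (m - x) := by
  have hr' : (0 : ℚ) < r := by exact_mod_cast hr
  rw [le_sub_comm, Int.ceil_le, div_le_iff₀ hr', mul_comm (r : ℤ)]
  exact_mod_cast Iff.rfl

/-- If `m * n ≤ r * (m - 1)` and `m` is coprime to `r`, then `n ≤ r - ⌊r / m⌋ - 1`. -/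
theorem le_sub_floor_sub_one {m r : ℕ} (hm : 2 ≤ m) (hmr : IsCoprime (m : ℤ) r) {n : ℤ}
    (h : (m : ℤ) * n ≤ r * (m - 1)) : n ≤ (r : ℤ) - ⌊(r : ℚ) / (m : ℚ)⌋ - 1 := by
  have hm' : (2 : ℤ) ≤ m := by exact_mod_cast hm
  have hfl : ⌊(r : ℚ) / (m : ℚ)⌋ = (r : ℤ) / m := Rat.floor_intCast_div_natCast r m
  rw [hfl]
  have hmod : (r : ℤ) % m ≠ 0 := fun h0 => by
    have := Int.isUnit_iff.mp (hmr.isUnit_of_dvd' dvd_rfl (Int.dvd_of_emod_eq_zero h0))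
    omega
  have h1 := Int.emod_add_mul_ediv (r : ℤ) m
  have h2 := Int.emod_nonneg (r : ℤ) (show (m : ℤ) ≠ 0 by omega)
  have h3 : 1 ≤ (r : ℤ) % m := by omega
  by_contra! h4
  have h5 : (r : ℤ) - r / m ≤ n := by omega
  nlinarith

theorem isArithPureGap_iff_exists_perm {m r s : ℕ} (hm : 2 ≤ m) (hr : 1 ≤ r) (hs : 1 ≤ s)
    (l : ℤ) (hmr : IsCoprime (m : ℤ) r) (hml : IsCoprime (m : ℤ) l) (lam : Fin (r + 1) → ℤ)
    (hlam : ∀ i : Fin (r + 1), lam i = if i = 0 then -(r : ℤ) * l else l)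
    (c : Fin s → Fin (r + 1)) (hc : Function.Injective c) (hc0 : ∀ i, c i ≠ 0)
    (a : Fin s → ℤ) :
    IsArithPureGap m r s lam c a ↔
      ∃ (kk jj : Fin s → ℤ) (σ : Equiv.Perm (Fin s)),
        (∀ i, 0 ≤ kk i) ∧
        (∑ i, kk i) ≤ (r : ℤ) - ⌊(r : ℚ) / (m : ℚ)⌋ - 1 - (s : ℤ) ∧
        (∀ i : Fin s, 1 ≤ jj (σ i) ∧
          jj (σ i) ≤ (m : ℤ) -
            ⌈((m : ℚ) * (((∑ x, kk x : ℤ) : ℚ) + ((i : ℕ) : ℚ) + 1)) / (r : ℚ)⌉) ∧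
        a = fun i => (m : ℤ) * kk i + jj i := by
  have hm' : (2 : ℤ) ≤ m := by exact_mod_cast hm
  have hr' : (1 : ℤ) ≤ r := by exact_mod_cast hr
  have hbound : ∀ (K : ℤ) (i : Fin s) (x : ℤ),
      x ≤ (m : ℤ) - ⌈((m : ℚ) * ((K : ℚ) + ((i : ℕ) : ℚ) + 1)) / (r : ℚ)⌉ ↔
        (m : ℤ) * (K + ((i + 1 : ℕ) : ℤ)) ≤ r * (m - x) := fun K i x => by
    rw [← le_sub_ceil_div_iff hr]
    push_cast
    rw [add_assoc]
  simp only [hbound]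
  rw [isArithPureGap_iff_forall_residue (by omega) l hml lam hlam c hc hc0]
  have hperm : ∀ (K : ℤ) (j : Fin s → ℤ),
      (∀ i, (m : ℤ) * (K + (#{x | j i ≤ j x} : ℤ)) ≤ r * (m - j i)) ↔
        ∃ σ : Equiv.Perm (Fin s), ∀ i : Fin s,
          (m : ℤ) * (K + ((i + 1 : ℕ) : ℤ)) ≤ r * (m - j (σ i)) := fun K j =>
    forall_card_iff_exists_perm j (fun n x => (m : ℤ) * (K + n) ≤ r * (m - x)) (by
      intro n n' x x' hn hx h
      have hn' : (n : ℤ) ≤ n' := by exact_mod_cast hn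
      nlinarith)
  constructor
  · rintro ⟨ha, h⟩
    have hmod : ∀ i, a i % m ≠ 0 := fun i hi => by
      rcases h 0 le_rfl (by omega) with h1 | h1
      · have : 0 ≤ ∑ i, (a i + 0) / (m : ℤ) :=
          Finset.sum_nonneg fun x _ => Int.ediv_nonneg (by linarith [ha x]) (by omega)
        simp only [mul_zero, neg_zero, Int.zero_ediv, add_zero] at h1 this
        omega
      · exact h1 i (by simpa using Int.dvd_of_emod_eq_zero hi)
    have hdecomp : a = fun i => (m : ℤ) * (a i / m) + a i % m :=
      funext fun i => (Int.mul_ediv_add_emod _ _).symm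
    have hj : ∀ i, 1 ≤ a i % m := fun i => by
      have := Int.emod_nonneg (a i) (show (m : ℤ) ≠ 0 by omega)
      have := hmod i
      omega
    rw [hdecomp] at h
    obtain ⟨σ, hσ⟩ := (hperm _ _).1 ((forall_residue_iff_card_bound hmr (fun i => a i / m)
      (fun i => a i % m) hj fun i => Int.emod_lt_of_pos _ (by omega)).1 h)
    refine ⟨_, _, σ, fun i => Int.ediv_nonneg (ha i) (by omega), ?_, fun i => ⟨hj _, hσ i⟩,
      hdecomp⟩
    rw [le_sub_iff_add_le]
    apply le_sub_floor_sub_one hm hmr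
    have h1 := hσ ⟨s - 1, by omega⟩
    have h2 := hj (σ ⟨s - 1, by omega⟩)
    rw [Nat.sub_add_cancel hs] at h1
    nlinarith
  · rintro ⟨kk, jj, σ, hkk, -, hjj, rfl⟩
    have hj : ∀ i, 1 ≤ jj i := fun i => by simpa using (hjj (σ.symm i)).1
    have hjm : ∀ i, jj i < m := fun i => by
      have h1 := (hjj (σ.symm i)).2
      rw [Equiv.apply_symm_apply] at h1
      have h2 : 0 ≤ ∑ x, kk x := Finset.sum_nonneg fun x _ => hkk x
      push_cast at h1
      by_contra! h3
      have h4 : (r : ℤ) * (m - jj i) ≤ 0 := by nlinarith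
      have h5 : (0 : ℤ) < m * (∑ x, kk x + (((σ.symm i : ℕ) : ℤ) + 1)) := by positivity
      linarith
    refine ⟨fun i => ?_, (forall_residue_iff_card_bound hmr kk jj hj hjm).2
      ((hperm _ _).2 ⟨σ, fun i => (hjj i).2⟩)⟩
    have := hj i
    have := hkk i
    positivity

/-- Explicit description of the set of pure gaps at finite indices `(1,…,s)` for equal
multiplicities (Proposition precise_puregap1). -/
theorem pureGaps_finite_description (m r : ℕ) (hm : 2 ≤ m) (hr : 1 ≤ r)
    (l : ℤ) (hl : l ≠ 0) (hgcd : Int.gcd (m : ℤ) ((r : ℤ) * l) = 1)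
    (lam : Fin (r + 1) → ℤ)
    (hlam : ∀ i : Fin (r + 1), lam i = if i = 0 then -(r : ℤ) * l else l)
    (s : ℕ) (hs1 : 2 ≤ s) (hsr : s ≤ r) :
    ((s : ℤ) ≤ (r : ℤ) - ⌊(r : ℚ) / (m : ℚ)⌋ - 1 →
      {a : Fin s → ℤ | IsArithPureGap m r s lam
          (fun i => Fin.castLE (Nat.succ_le_succ hsr) i.succ) a} =
        {b : Fin s → ℤ |
          ∃ (kk jj : Fin s → ℤ) (σ : Equiv.Perm (Fin s)),
            (∀ i, 0 ≤ kk i) ∧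
            (∑ i, kk i) ≤ (r : ℤ) - ⌊(r : ℚ) / (m : ℚ)⌋ - 1 - (s : ℤ) ∧
            (∀ i : Fin s, 1 ≤ jj (σ i) ∧
              jj (σ i) ≤ (m : ℤ) -
                ⌈((m : ℚ) * (((∑ x, kk x : ℤ) : ℚ) + ((i : ℕ) : ℚ) + 1)) / (r : ℚ)⌉) ∧
            b = fun i => (m : ℤ) * kk i + jj i}) ∧
    ((r : ℤ) - ⌊(r : ℚ) / (m : ℚ)⌋ ≤ (s : ℤ) →
      ∀ a : Fin s → ℤ, ¬ IsArithPureGap m r s lam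
        (fun i => Fin.castLE (Nat.succ_le_succ hsr) i.succ) a) := by
  have hcop := Int.isCoprime_iff_gcd_eq_one.mpr hgcd
  have key := isArithPureGap_iff_exists_perm hm hr (by omega) l hcop.of_mul_right_left
    hcop.of_mul_right_right lam hlam (fun i => Fin.castLE (Nat.succ_le_succ hsr) i.succ)
    (fun i i' h => Fin.succ_injective _ (Fin.castLE_injective _ h))
    (fun i h => by simpa using congrArg Fin.val h)
  refine ⟨fun _ => Set.ext key, fun hs a ha => ?_⟩
  obtain ⟨kk, -, -, hkk, hle, -⟩ := (key a).1 ha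
  have := Finset.sum_nonneg fun i (_ : i ∈ Finset.univ) => hkk i
  linarith
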